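/- (Corollary 3) The feasible set of the max-Dombi system is the union of finitely many boxes: S = ⋃_{e ∈ Ē} {x ∈ [0,1]^n : X(e) ≤ x ≤ X̄ componentwise}, where Ē is the set of selections e with e(i) ∈ J̄_i for all i, J̄_i = {j : ā_ij ≥ b_i}, and Ā is the reduced matrix. -/

import Mathlib

open scoped Classical

/-- The Dombi t-norm with parameter `l`. -/
noncomputable def dombi (l x y : ℝ) : ℝ :=
  if x = 0 ∨ y = 0 then 0
  else (1 + (((1 - x) / x) ^ l + ((1 - y) / y) ^ l) ^ (1 / l))⁻¹

/-- The solving operation `V(b, a)` associated with the Dombi t-norm. -/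
noncomputable def V (l b a : ℝ) : ℝ :=
  (1 + (((1 - b) / b) ^ l - ((1 - a) / a) ^ l) ^ (1 / l))⁻¹

/-- The feasible set `S` of the max-Dombi system `A φ x = b` inside `[0,1]^n`. -/
def feasible (l : ℝ) {m n : ℕ} (A : Fin (m + 1) → Fin (n + 1) → ℝ)
    (b : Fin (m + 1) → ℝ) : Set (Fin (n + 1) → ℝ) :=
  {x | (∀ j, x j ∈ Set.Icc (0 : ℝ) 1) ∧
    ∀ i, Finset.univ.sup' Finset.univ_nonempty (fun j => dombi l (A i j) (x j)) = b i}

/-- The vectors `x̂ᵢ` used to build the candidate maximum solution. -/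
noncomputable def xhat (l : ℝ) {m n : ℕ} (A : Fin (m + 1) → Fin (n + 1) → ℝ)
    (b : Fin (m + 1) → ℝ) (i : Fin (m + 1)) (j : Fin (n + 1)) : ℝ :=
  if 0 < b i ∧ b i ≤ A i j then V l (b i) (A i j)
  else if b i = 0 ∧ 0 < A i j then 0
  else 1

/-- The candidate maximum solution `X̄` of the max-Dombi system. -/
noncomputable def Xbar (l : ℝ) {m n : ℕ} (A : Fin (m + 1) → Fin (n + 1) → ℝ)
    (b : Fin (m + 1) → ℝ) (j : Fin (n + 1)) : ℝ :=
  Finset.univ.inf' Finset.univ_nonempty (fun i => xhat l A b i j)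

/-- The vector `x̌ᵢ(j)`: its `k`-th component is `V(bᵢ, aᵢⱼ)` if `bᵢ > 0` and `k = j`,
and `0` otherwise. -/
noncomputable def xcheck (l : ℝ) {m n : ℕ} (A : Fin (m + 1) → Fin (n + 1) → ℝ)
    (b : Fin (m + 1) → ℝ) (i : Fin (m + 1)) (j k : Fin (n + 1)) : ℝ :=
  if 0 < b i ∧ k = j then V l (b i) (A i j) else 0

/-- The candidate minimal solution `X(e)` associated with a selection `e`. -/
noncomputable def Xe (l : ℝ) {m n : ℕ} (A : Fin (m + 1) → Fin (n + 1) → ℝ)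
    (b : Fin (m + 1) → ℝ) (e : Fin (m + 1) → Fin (n + 1)) (j : Fin (n + 1)) : ℝ :=
  Finset.univ.sup' Finset.univ_nonempty (fun i => xcheck l A b i (e i) j)

/-- The reduced matrix `Ā` obtained from `A` by the simplification steps
(I), (II) and (III) of Theorem 1. -/
noncomputable def Abar (l : ℝ) {m n : ℕ} (A : Fin (m + 1) → Fin (n + 1) → ℝ)
    (b : Fin (m + 1) → ℝ) (i : Fin (m + 1)) (j : Fin (n + 1)) : ℝ :=
  if A i j < b i then 0
  else if 0 < b i ∧ ∃ i', i' ≠ i ∧ 0 < b i' ∧ b i' ≤ A i' j ∧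
      V l (b i') (A i' j) < V l (b i) (A i j) then 0
  else if 0 < b i ∧ ∃ i', i' ≠ i ∧ b i' = 0 ∧ 0 < A i' j then 0
  else A i j

lemma odds_nonneg {x : ℝ} (hx0 : 0 < x) (hx1 : x ≤ 1) : 0 ≤ (1 - x) / x :=
  div_nonneg (sub_nonneg.2 hx1) hx0.le

lemma inv_one_add_odds {x : ℝ} (hx0 : 0 < x) : (1 + (1 - x) / x)⁻¹ = x := by
  field_simp
  ring

lemma inv_one_add_le_inv_one_add {u v : ℝ} (hu : 0 ≤ u) (hv : 0 ≤ v) :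
    (1 + u)⁻¹ ≤ (1 + v)⁻¹ ↔ v ≤ u := by
  rw [inv_le_inv₀ (by linarith) (by linarith)]
  exact add_le_add_iff_left 1

lemma V_pos {l b a : ℝ} (hl : 0 < l) (hb : 0 < b) (hab : b ≤ a) (ha : a ≤ 1) :
    0 < V l b a := by
  have hodds : (1 - a) / a ≤ (1 - b) / b := by
    rw [div_le_div_iff₀ (hb.trans_le hab) hb]
    nlinarith
  have hpow := Real.rpow_le_rpow (odds_nonneg (hb.trans_le hab) ha) hodds hl.le
  have := Real.rpow_nonneg (sub_nonneg.2 hpow) (1 / l)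
  unfold V
  positivity

lemma dombi_pos {l x y : ℝ} (hx0 : 0 < x) (hx1 : x ≤ 1) (hy0 : 0 < y) (hy1 : y ≤ 1) :
    0 < dombi l x y := by
  rw [dombi, if_neg (by simp [hx0.ne', hy0.ne'])]
  have := odds_nonneg hx0 hx1
  have := odds_nonneg hy0 hy1
  positivity

lemma dombi_zero_left (l y : ℝ) : dombi l 0 y = 0 := by simp [dombi]

lemma dombi_zero_right (l x : ℝ) : dombi l x 0 = 0 := by simp [dombi]

lemma dombi_nonneg {l x y : ℝ} (hx : x ∈ Set.Icc (0 : ℝ) 1) (hy : y ∈ Set.Icc (0 : ℝ) 1) :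
    0 ≤ dombi l x y := by
  rcases hx.1.eq_or_lt with rfl | hx0
  · rw [dombi_zero_left]
  rcases hy.1.eq_or_lt with rfl | hy0
  · rw [dombi_zero_right]
  exact (dombi_pos hx0 hx.2 hy0 hy.2).le

lemma dombi_le_left {l x y : ℝ} (hl : 0 < l) (hx : x ∈ Set.Icc (0 : ℝ) 1)
    (hy : y ∈ Set.Icc (0 : ℝ) 1) : dombi l x y ≤ x := by
  rcases hx.1.eq_or_lt with rfl | hx0
  · rw [dombi_zero_left]
  rcases hy.1.eq_or_lt with rfl | hy0
  · rw [dombi_zero_right]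
    exact hx.1
  rw [dombi, if_neg (by simp [hx0.ne', hy0.ne'])]
  have h1 := odds_nonneg hx0 hx.2
  have h2 := odds_nonneg hy0 hy.2
  conv_rhs => rw [← inv_one_add_odds hx0]
  rw [inv_one_add_le_inv_one_add (by positivity) h1, one_div,
    Real.le_rpow_inv_iff_of_pos h1 (by positivity) hl]
  exact le_add_of_nonneg_right (by positivity)

lemma dombi_le_iff_le_V {l a b x : ℝ} (hl : 0 < l) (hb : 0 < b) (hab : b ≤ a) (ha : a ≤ 1)
    (hx : x ∈ Set.Icc (0 : ℝ) 1) : dombi l a x ≤ b ↔ x ≤ V l b a := by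
  rcases hx.1.eq_or_lt with rfl | hx0
  · rw [dombi_zero_right]
    exact iff_of_true hb.le (V_pos hl hb hab ha).le
  have ha0 := hb.trans_le hab
  have h1 := odds_nonneg ha0 ha
  have h2 := odds_nonneg hx0 hx.2
  have h3 := odds_nonneg hb (hab.trans ha)
  have hodds : (1 - a) / a ≤ (1 - b) / b := by
    rw [div_le_div_iff₀ ha0 hb]
    nlinarith
  have hpow := sub_nonneg.2 (Real.rpow_le_rpow h1 hodds hl.le)
  rw [dombi, if_neg (by simp [ha0.ne', hx0.ne']), V]
  nth_rewrite 1 [← inv_one_add_odds hb]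
  nth_rewrite 3 [← inv_one_add_odds hx0]
  rw [inv_one_add_le_inv_one_add (by positivity) h3,
    inv_one_add_le_inv_one_add h2 (Real.rpow_nonneg hpow _), one_div,
    Real.le_rpow_inv_iff_of_pos h3 (by positivity) hl, Real.rpow_inv_le_iff_of_pos hpow h2 hl,
    sub_le_iff_le_add']

lemma le_dombi_iff_V_le {l a b x : ℝ} (hl : 0 < l) (hb : 0 < b) (hab : b ≤ a) (ha : a ≤ 1)
    (hx : x ∈ Set.Icc (0 : ℝ) 1) : b ≤ dombi l a x ↔ V l b a ≤ x := by
  rcases hx.1.eq_or_lt with rfl | hx0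
  · rw [dombi_zero_right]
    exact iff_of_false hb.not_ge (V_pos hl hb hab ha).not_ge
  have ha0 := hb.trans_le hab
  have h1 := odds_nonneg ha0 ha
  have h2 := odds_nonneg hx0 hx.2
  have h3 := odds_nonneg hb (hab.trans ha)
  have hodds : (1 - a) / a ≤ (1 - b) / b := by
    rw [div_le_div_iff₀ ha0 hb]
    nlinarith
  have hpow := sub_nonneg.2 (Real.rpow_le_rpow h1 hodds hl.le)
  rw [dombi, if_neg (by simp [ha0.ne', hx0.ne']), V]
  nth_rewrite 1 [← inv_one_add_odds hb]
  nth_rewrite 3 [← inv_one_add_odds hx0]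
  rw [inv_one_add_le_inv_one_add h3 (by positivity),
    inv_one_add_le_inv_one_add (Real.rpow_nonneg hpow _) h2, one_div,
    Real.rpow_inv_le_iff_of_pos (by positivity) h3 hl, Real.le_rpow_inv_iff_of_pos h2 hpow hl,
    le_sub_iff_add_le']

lemma dombi_le_iff_le_xhat {l : ℝ} (hl : 0 < l) {m n : ℕ}
    {A : Fin (m + 1) → Fin (n + 1) → ℝ} {b : Fin (m + 1) → ℝ}
    (hA : ∀ i j, A i j ∈ Set.Icc (0 : ℝ) 1) (hb : ∀ i, b i ∈ Set.Icc (0 : ℝ) 1)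
    (i : Fin (m + 1)) (j : Fin (n + 1)) {t : ℝ} (ht : t ∈ Set.Icc (0 : ℝ) 1) :
    dombi l (A i j) t ≤ b i ↔ t ≤ xhat l A b i j := by
  unfold xhat
  split_ifs with h1 h2
  · exact dombi_le_iff_le_V hl h1.1 h1.2 (hA i j).2 ht
  · rw [h2.1]
    refine ⟨fun h => ?_, fun h => ?_⟩
    · by_contra! h0
      exact (dombi_pos h2.2 (hA i j).2 h0 ht.2).not_ge h
    · rw [le_antisymm h ht.1, dombi_zero_right]
  · refine iff_of_true ?_ ht.2
    refine (dombi_le_left hl (hA i j) ht).trans ?_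
    rcases (hb i).1.eq_or_lt with h0 | h0
    · exact h0 ▸ not_lt.1 fun h => h2 ⟨h0.symm, h⟩
    · exact (not_le.1 fun h => h1 ⟨h0, h⟩).le

lemma V_le_of_Xe_le {l : ℝ} {m n : ℕ} {A : Fin (m + 1) → Fin (n + 1) → ℝ}
    {b : Fin (m + 1) → ℝ} {e : Fin (m + 1) → Fin (n + 1)} {i : Fin (m + 1)} {t : ℝ}
    (hi : 0 < b i) (h : Xe l A b e (e i) ≤ t) : V l (b i) (A i (e i)) ≤ t := by
  have := (Finset.sup'_le_iff _ _).1 h i (Finset.mem_univ i)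
  rwa [xcheck, if_pos ⟨hi, rfl⟩] at this

lemma le_of_le_Abar {l : ℝ} {m n : ℕ} {A : Fin (m + 1) → Fin (n + 1) → ℝ}
    {b : Fin (m + 1) → ℝ} {i : Fin (m + 1)} {j : Fin (n + 1)}
    (hi : 0 < b i) (h : b i ≤ Abar l A b i j) : b i ≤ A i j := by
  by_contra! hlt
  rw [Abar, if_pos hlt] at h
  exact hi.not_ge h

lemma Abar_eq_of_V_le_Xbar {l : ℝ} (hl : 0 < l) {m n : ℕ}
    {A : Fin (m + 1) → Fin (n + 1) → ℝ} {b : Fin (m + 1) → ℝ} {i : Fin (m + 1)}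
    {j : Fin (n + 1)} (ha : A i j ≤ 1) (hi : 0 < b i) (hij : b i ≤ A i j)
    (h : V l (b i) (A i j) ≤ Xbar l A b j) : Abar l A b i j = A i j := by
  have hx : ∀ i', V l (b i) (A i j) ≤ xhat l A b i' j := fun i' =>
    (Finset.le_inf'_iff _ _).1 h i' (Finset.mem_univ i')
  rw [Abar, if_neg hij.not_gt, if_neg, if_neg]
  · rintro ⟨-, i', -, h0, hA0⟩
    have := hx i'
    rw [xhat, if_neg (by simp [h0]), if_pos ⟨h0, hA0⟩] at this
    exact (V_pos hl hi hij ha).not_ge this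
  · rintro ⟨-, i', -, h0, hA0, hV⟩
    have := hx i'
    rw [xhat, if_pos ⟨h0, hA0⟩] at this
    exact hV.not_ge this

lemma le_Abar_of_eq_zero {l : ℝ} {m n : ℕ} {A : Fin (m + 1) → Fin (n + 1) → ℝ}
    {b : Fin (m + 1) → ℝ} {i : Fin (m + 1)} {j : Fin (n + 1)}
    (ha : 0 ≤ A i j) (hi : b i = 0) : b i ≤ Abar l A b i j := by
  simp [Abar, hi, ha.not_gt, ha]

/-- (Corollary 3) The feasible set of the max-Dombi system equals the union, over
selections `e ∈ Ē`, of the boxes `[X(e), X̄]` inside `[0,1]^n`. -/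
theorem feasible_eq_union_boxes (l : ℝ) (hl : 0 < l) {m n : ℕ}
    (A : Fin (m + 1) → Fin (n + 1) → ℝ) (b : Fin (m + 1) → ℝ)
    (hA : ∀ i j, A i j ∈ Set.Icc (0 : ℝ) 1) (hb : ∀ i, b i ∈ Set.Icc (0 : ℝ) 1) :
    feasible l A b =
      ⋃ e ∈ {e : Fin (m + 1) → Fin (n + 1) | ∀ i, b i ≤ Abar l A b i (e i)},
        {x : Fin (n + 1) → ℝ | (∀ j, x j ∈ Set.Icc (0 : ℝ) 1) ∧
          ∀ j, Xe l A b e j ≤ x j ∧ x j ≤ Xbar l A b j} := by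
  ext x
  simp only [feasible, Set.mem_ofPred_eq, Set.mem_iUnion, exists_prop]
  have hbar (hx : ∀ j, x j ∈ Set.Icc (0 : ℝ) 1) :
      (∀ j, x j ≤ Xbar l A b j) ↔ ∀ i j, dombi l (A i j) (x j) ≤ b i := by
    simp only [Xbar, Finset.le_inf'_iff, Finset.mem_univ, true_implies]
    rw [forall_comm]
    exact forall₂_congr fun i j => (dombi_le_iff_le_xhat hl hA hb i j (hx j)).symm
  constructor
  · rintro ⟨hx, hS⟩
    have hle : ∀ j, x j ≤ Xbar l A b j := (hbar hx).2 fun i j =>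
      hS i ▸ Finset.le_sup' (fun j => dombi l (A i j) (x j)) (Finset.mem_univ j)
    have hsel : ∀ i, ∃ j, b i ≤ Abar l A b i j ∧ (0 < b i → V l (b i) (A i j) ≤ x j) := by
      intro i
      rcases (hb i).1.eq_or_lt with h0 | h0
      · exact ⟨0, le_Abar_of_eq_zero (hA i 0).1 h0.symm, fun h => absurd h0 h.ne⟩
      obtain ⟨j, -, hj⟩ := Finset.exists_mem_eq_sup' Finset.univ_nonempty
        (fun j => dombi l (A i j) (x j))
      rw [hS i] at hj
      have hij : b i ≤ A i j := hj.le.trans (dombi_le_left hl (hA i j) (hx j))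
      have hV := (le_dombi_iff_V_le hl h0 hij (hA i j).2 (hx j)).1 hj.le
      refine ⟨j, ?_, fun _ => hV⟩
      rwa [Abar_eq_of_V_le_Xbar hl (hA i j).2 h0 hij (hV.trans (hle j))]
    choose e he hV using hsel
    refine ⟨e, he, hx, fun j => ⟨Finset.sup'_le _ _ fun i _ => ?_, hle j⟩⟩
    unfold xcheck
    split_ifs with h
    · rw [h.2]
      exact hV i h.1
    · exact (hx j).1
  · rintro ⟨e, he, hx, hbox⟩
    refine ⟨hx, fun i => le_antisymm ?_ ?_⟩
    · exact Finset.sup'_le _ _ fun j _ => (hbar hx).1 (fun j => (hbox j).2) i j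
    · refine le_trans ?_ (Finset.le_sup' (fun j => dombi l (A i j) (x j))
        (Finset.mem_univ (e i)))
      rcases (hb i).1.eq_or_lt with h0 | h0
      · exact h0 ▸ dombi_nonneg (hA i _) (hx _)
      · exact (le_dombi_iff_V_le hl h0 (le_of_le_Abar h0 (he i)) (hA i _).2 (hx _)).2
          (V_le_of_Xe_le h0 (hbox _).1)
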